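/- Suppose the input maps X^in(i,j), 1 ≤ i < j ≤ n, are generated according to the random corruption model, and let α, β > 0 be parameters independent of n and d. If p_true ≥ α/2 and d = d(n) satisfies d(n)⁴ log(n)/n → 0, then with probability tending to 1 as n → ∞, condition (C2) holds strictly: for all t,q ∈ [d] and all 1 ≤ i < j ≤ n with a_tt(i,j) = a_qq(i,j) = 1 and a_tq(i,j) = −1, both δ_{t→q}^{i→j} > 1 and δ_{q→t}^{j→i} > 1. -/

import Mathlib

open Matrix
open scoped Classical

noncomputable section

/-- The permutation matrix of a permutation `σ` of `Fin d`. -/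
def permMat (d : ℕ) (σ : Equiv.Perm (Fin d)) : Matrix (Fin d) (Fin d) ℝ :=
  Matrix.of fun t q => if σ q = t then 1 else 0

/-- The objective function of the basic LP (P):
`∑_{i<j} ∑_{t,q} a_{tq}(i,j) X_{tq}(i,j)`. -/
def lpObj (n d : ℕ) (a X : Fin n → Fin n → Matrix (Fin d) (Fin d) ℝ) : ℝ :=
  ∑ p ∈ Finset.univ.filter (fun p : Fin n × Fin n => p.1 < p.2),
    ∑ t : Fin d, ∑ q : Fin d, a p.1 p.2 t q * X p.1 p.2 t q

/-- The feasible region of the basic LP (P): all row and column sums equal one,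
the triangle inequalities hold, and all entries are nonnegative. -/
def lpFeasible (n d : ℕ) (X : Fin n → Fin n → Matrix (Fin d) (Fin d) ℝ) : Prop :=
  (∀ i j : Fin n, i < j → ∀ t : Fin d, ∑ q : Fin d, X i j t q = 1) ∧
  (∀ i j : Fin n, i < j → ∀ q : Fin d, ∑ t : Fin d, X i j t q = 1) ∧
  (∀ i j k : Fin n, i < j → j < k → ∀ l t q : Fin d,
      X i j l t + X j k t q - X i k l q ≤ 1 ∧
      X i j l t - X j k t q + X i k l q ≤ 1 ∧
      - X i j l t + X j k t q + X i k l q ≤ 1) ∧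
  (∀ i j : Fin n, i < j → ∀ t q : Fin d, 0 ≤ X i j t q)

/-- The quantity `δ_{t→q}^{i→j}` of the dual certificate. -/
def deltaJOM (n d : ℕ) (a : Fin n → Fin n → Matrix (Fin d) (Fin d) ℝ) (α β : ℝ)
    (i j : Fin n) (t q : Fin d) : ℝ :=
  (1 / (n : ℝ)) *
    ∑ k ∈ Finset.univ.filter (fun k : Fin n => k ≠ i ∧ k ≠ j ∧ a k i t t = -1),
      ((a k j t q - a i j t q) / α + (a i j t t - a k j t t) / (β * d))

/-- The quantity `κ_t(i,j)` of the dual certificate. -/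
def kappaJOM (n d : ℕ) (a : Fin n → Fin n → Matrix (Fin d) (Fin d) ℝ) (α β : ℝ)
    (i j : Fin n) (t : Fin d) : ℝ :=
  (1 / (n : ℝ)) *
      ∑ l ∈ Finset.univ.filter (fun l : Fin d => l ≠ t),
        ∑ k ∈ Finset.univ.filter (fun k : Fin n => k ≠ i ∧ k ≠ j),
          min (a k i l t / α + a k j t t / (β * d)) (a k j l t / α + a k i t t / (β * d))
    + (1 / (n : ℝ)) * (1 / (2 * α) - ((d : ℝ) - 1) / (2 * β * d)) *
        ((∑ k ∈ Finset.univ.filter (fun k : Fin n => k ≠ i), a k i t t) +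
          ∑ k ∈ Finset.univ.filter (fun k : Fin n => k ≠ j), a k j t t)
    - ((d : ℝ) - 2) / α + 1
    + (1 / (2 * (n : ℝ))) *
        ∑ l ∈ Finset.univ.filter (fun l : Fin d => l ≠ t),
          ((a i j t l + a j i t l) / α + 2 * a i j t t / (β * d))

/-- A sample of the random corruption model: for each (ordered) pair of objects, a
Bernoulli coin and a uniformly random permutation. -/
abbrev Sample (n d : ℕ) := Fin n → Fin n → Bool × Equiv.Perm (Fin d)

/-- The probability weight of a sample: each coin is heads with probability `p`, each
permutation is uniform among the `d!` permutations, all independently. -/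
def wtJOM (n d : ℕ) (p : ℝ) (ω : Sample n d) : ℝ :=
  ∏ i : Fin n, ∏ j : Fin n,
    ((if (ω i j).1 then p else 1 - p) / (Nat.factorial d : ℝ))

/-- The probability of an event under the random corruption model. -/
def prJOM (n d : ℕ) (p : ℝ) (E : Sample n d → Prop) : ℝ :=
  ∑ ω : Sample n d, if E ω then wtJOM n d p ω else 0

/-- The random input map for a pair `i < j`: the identity (ground truth) if the coin
shows heads, and an independent uniformly random permutation matrix otherwise. -/
def baseMat (n d : ℕ) (ω : Sample n d) (i j : Fin n) : Matrix (Fin d) (Fin d) ℝ :=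
  if (ω i j).1 then 1 else permMat d (ω i j).2

/-- The full collection of random input maps, extended by transposition:
`X^in(j,i) = X^in(i,j)ᵀ`. -/
def XinRand (n d : ℕ) (ω : Sample n d) (i j : Fin n) : Matrix (Fin d) (Fin d) ℝ :=
  if i < j then baseMat n d ω i j else if j < i then (baseMat n d ω j i)ᵀ else 1

/-- The random coefficients `a_{tq}(i,j) = 1 - 2 X^in_{tq}(i,j)`. -/
def aRand (n d : ℕ) (ω : Sample n d) (i j : Fin n) : Matrix (Fin d) (Fin d) ℝ :=
  Matrix.of fun t q => 1 - 2 * XinRand n d ω i j t q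

lemma factorPairs {ι A K : Type} [Fintype ι] [DecidableEq ι] [Fintype A] [Fintype K]
    (w : A → ℝ) (hw : ∑ a, w a = 1) (e1 e2 : K → ι)
    (hinj : Function.Injective (Sum.elim e1 e2)) (h : K → A → A → ℝ) :
    ∑ ω : ι → A, (∏ x, w (ω x)) * ∏ k, h k (ω (e1 k)) (ω (e2 k))
      = ∏ k, ∑ a, ∑ b, w a * w b * h k a b := by
  let e : (K ⊕ K) ⊕ ↥(Set.range (Sum.elim e1 e2))ᶜ ≃ ι :=
    ((Equiv.ofInjective _ hinj).sumCongr (Equiv.refl _)).trans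
      (Equiv.Set.sumCompl (Set.range (Sum.elim e1 e2)))
  have he1 : ∀ k, e (Sum.inl (Sum.inl k)) = e1 k := fun k => by simp [e]
  have he2 : ∀ k, e (Sum.inl (Sum.inr k)) = e2 k := fun k => by simp [e]
  rw [← (Equiv.arrowCongr e (Equiv.refl A)).sum_comp]
  have h1 : ∀ (τ : (K ⊕ K) ⊕ ↥(Set.range (Sum.elim e1 e2))ᶜ → A),
      (∏ x, w ((Equiv.arrowCongr e (Equiv.refl A)) τ x)) *
        ∏ k, h k ((Equiv.arrowCongr e (Equiv.refl A)) τ (e1 k))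
          ((Equiv.arrowCongr e (Equiv.refl A)) τ (e2 k))
      = (∏ k, (w (τ (Sum.inl (Sum.inl k))) * w (τ (Sum.inl (Sum.inr k))) *
          h k (τ (Sum.inl (Sum.inl k))) (τ (Sum.inl (Sum.inr k))))) *
          ∏ r, w (τ (Sum.inr r)) := by
    intro τ
    rw [← e.prod_comp]
    simp only [← he1, ← he2, Equiv.arrowCongr_apply, Function.comp, Equiv.symm_apply_apply,
      Equiv.refl_apply, Fintype.prod_sum_type, Finset.prod_mul_distrib]
    ring
  simp only [h1]
  rw [← (Equiv.sumArrowEquivProdArrow (K ⊕ K) (↥(Set.range (Sum.elim e1 e2))ᶜ) A).symm.sum_comp]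
  rw [Fintype.sum_prod_type]
  simp only [Equiv.sumArrowEquivProdArrow_symm_apply_inl,
    Equiv.sumArrowEquivProdArrow_symm_apply_inr]
  simp only [← Finset.mul_sum]
  have h2 : ∑ ρ : ↥(Set.range (Sum.elim e1 e2))ᶜ → A, ∏ r, w (ρ r) = 1 := by
    have := (Fintype.prod_sum (fun (_ : ↥(Set.range (Sum.elim e1 e2))ᶜ) (a : A) => w a))
    rw [← this]; simp [hw]
  simp only [h2, mul_one]
  rw [← (Equiv.sumArrowEquivProdArrow K K A).symm.sum_comp]
  rw [← (Equiv.arrowProdEquivProdArrow K (fun _ => A) (fun _ => A)).sum_comp]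
  simp only [Equiv.sumArrowEquivProdArrow_symm_apply_inl,
    Equiv.sumArrowEquivProdArrow_symm_apply_inr, Equiv.arrowProdEquivProdArrow_apply]
  have h3 := (Fintype.prod_sum (fun (k : K) (ab : A × A) => w ab.1 * w ab.2 * h k ab.1 ab.2))
  rw [← h3]
  simp only [Fintype.sum_prod_type]

lemma exp_neg_le {x : ℝ} (hx : 0 ≤ x) (hx1 : x ≤ 1) : Real.exp (-x) ≤ 1 - x + x ^ 2 := by
  have := Real.abs_exp_sub_one_sub_id_le (x := -x) (by rw [abs_neg, abs_of_nonneg hx]; exact hx1)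
  have := (abs_le.1 this).2
  nlinarith

lemma chernoff {ι A K : Type} [Fintype ι] [DecidableEq ι] [Fintype A] [Fintype K]
    (w : A → ℝ) (hw0 : ∀ a, 0 ≤ w a) (hw : ∑ a, w a = 1) (e1 e2 : K → ι)
    (hinj : Function.Injective (Sum.elim e1 e2)) (g : K → A → A → ℝ) (M m ε : ℝ)
    (hM : 0 < M) (hε : 0 ≤ ε) (hεM : ε ≤ M)
    (hg0 : ∀ k a b, 0 ≤ g k a b) (hgM : ∀ k a b, g k a b ≤ M)
    (hm : ∀ k, m ≤ ∑ a, ∑ b, w a * w b * g k a b) :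
    ∑ ω : ι → A, (if ∑ k, g k (ω (e1 k)) (ω (e2 k)) ≤ Fintype.card K * (m - ε)
        then ∏ x, w (ω x) else 0)
      ≤ Real.exp (- (Fintype.card K * (ε ^ 2 / (4 * M ^ 2)))) := by
  set l : ℝ := ε / (2 * M ^ 2) with hl
  have hl0 : 0 ≤ l := by positivity
  have hlM : l * M ≤ 1 := by
    rw [hl, div_mul_eq_mul_div, div_le_one (by positivity)]; nlinarith
  set N : ℝ := (Fintype.card K : ℝ) with hN
  have hw2 : ∑ a, ∑ b, w a * w b = 1 := by
    simp only [← Finset.mul_sum, hw, mul_one]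
  have step1 : ∑ ω : ι → A, (if ∑ k, g k (ω (e1 k)) (ω (e2 k)) ≤ N * (m - ε)
        then ∏ x, w (ω x) else 0)
      ≤ ∑ ω : ι → A, Real.exp (l * (N * (m - ε))) *
        ((∏ x, w (ω x)) * ∏ k, Real.exp (-(l * g k (ω (e1 k)) (ω (e2 k))))) := by
    refine Finset.sum_le_sum fun ω _ => ?_
    have hW : 0 ≤ ∏ x, w (ω x) := Finset.prod_nonneg fun _ _ => hw0 _
    split_ifs with hc
    · rw [← Real.exp_sum, mul_left_comm, ← Real.exp_add]
      refine le_mul_of_one_le_right hW (Real.one_le_exp ?_)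
      rw [Finset.sum_neg_distrib, ← Finset.mul_sum]
      nlinarith [mul_le_mul_of_nonneg_left hc hl0]
    · exact mul_nonneg (Real.exp_nonneg _)
        (mul_nonneg hW (Finset.prod_nonneg fun _ _ => Real.exp_nonneg _))
  refine step1.trans ?_
  rw [← Finset.mul_sum,
    factorPairs w hw e1 e2 hinj (fun k a b => Real.exp (-(l * g k a b)))]
  have step2 : ∀ k, ∑ a, ∑ b, w a * w b * Real.exp (-(l * g k a b))
      ≤ Real.exp (-(l * m) + l ^ 2 * M ^ 2) := by
    intro k
    have : ∑ a, ∑ b, w a * w b * Real.exp (-(l * g k a b))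
        ≤ ∑ a, ∑ b, (w a * w b * (1 + l ^ 2 * M ^ 2) - l * (w a * w b * g k a b)) := by
      refine Finset.sum_le_sum fun a _ => Finset.sum_le_sum fun b _ => ?_
      have h1 : 0 ≤ l * g k a b := mul_nonneg hl0 (hg0 k a b)
      have h2 : l * g k a b ≤ l * M := mul_le_mul_of_nonneg_left (hgM k a b) hl0
      have h3 := exp_neg_le h1 (h2.trans hlM)
      have h4 : (l * g k a b) ^ 2 ≤ l ^ 2 * M ^ 2 := by
        rw [← mul_pow]; exact pow_le_pow_left₀ h1 h2 2
      have h5 : 0 ≤ w a * w b := mul_nonneg (hw0 a) (hw0 b)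
      have := mul_le_mul_of_nonneg_left (h3.trans (add_le_add_right h4 (1 - l * g k a b))) h5
      refine this.trans (le_of_eq (by ring))
    refine this.trans ?_
    simp only [Finset.sum_sub_distrib, ← Finset.mul_sum, ← Finset.sum_mul, hw]
    have h6 := mul_le_mul_of_nonneg_left (hm k) hl0
    have h7 := Real.add_one_le_exp (-(l * m) + l ^ 2 * M ^ 2)
    simp only [Finset.mul_sum] at h6 ⊢
    linarith
  have step3 : ∏ k, ∑ a, ∑ b, w a * w b * Real.exp (-(l * g k a b))
      ≤ Real.exp (N * (-(l * m) + l ^ 2 * M ^ 2)) := by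
    calc _ ≤ ∏ _k : K, Real.exp (-(l * m) + l ^ 2 * M ^ 2) := by
          refine Finset.prod_le_prod (fun k _ => ?_) fun k _ => step2 k
          exact Finset.sum_nonneg fun a _ => Finset.sum_nonneg fun b _ =>
            mul_nonneg (mul_nonneg (hw0 a) (hw0 b)) (Real.exp_nonneg _)
      _ = _ := by rw [Finset.prod_const, ← Real.exp_nat_mul]; simp [hN]
  refine (mul_le_mul_of_nonneg_left step3 (Real.exp_nonneg _)).trans ?_
  rw [← Real.exp_add]
  apply le_of_eq
  congr 1
  rw [hl]
  field_simp
  ring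

/-- Weight of a single coordinate. -/
def bw (d : ℕ) (p : ℝ) (a : Bool × Equiv.Perm (Fin d)) : ℝ :=
  (if a.1 then p else 1 - p) / (Nat.factorial d : ℝ)

/-- Matrix of a single coordinate. -/
def bx (d : ℕ) (a : Bool × Equiv.Perm (Fin d)) : Matrix (Fin d) (Fin d) ℝ :=
  if a.1 then 1 else permMat d a.2

lemma bw_nonneg {d : ℕ} {p : ℝ} (hp0 : 0 ≤ p) (hp1 : p ≤ 1) (a) : 0 ≤ bw d p a := by
  unfold bw
  split_ifs
  · positivity
  · exact div_nonneg (by linarith) (by positivity)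

lemma sum_bw (d : ℕ) (p : ℝ) : ∑ a, bw d p a = 1 := by
  have : (Nat.factorial d : ℝ) ≠ 0 := by positivity
  rw [Fintype.sum_prod_type]
  simp [bw, Fintype.card_perm]
  field_simp
  ring

lemma sum_permMat (d : ℕ) (u v : Fin d) :
    (∑ σ : Equiv.Perm (Fin d), permMat d σ u v) * d = Nat.factorial d := by
  have h1 : ∀ u', ∑ σ : Equiv.Perm (Fin d), permMat d σ u' v
      = ∑ σ : Equiv.Perm (Fin d), permMat d σ u v := by
    intro u'
    rw [← Equiv.sum_comp (Equiv.mulLeft (Equiv.swap u u'))]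
    refine Finset.sum_congr rfl fun σ _ => ?_
    simp only [permMat, Matrix.of_apply, Equiv.coe_mulLeft, Equiv.Perm.coe_mul,
      Function.comp]
    have : Equiv.swap u u' (σ v) = u' ↔ σ v = u := by
      rw [Equiv.swap_apply_eq_iff, Equiv.swap_apply_right]
    simp only [this]
  have h2 : ∑ u' : Fin d, ∑ σ : Equiv.Perm (Fin d), permMat d σ u' v = Nat.factorial d := by
    rw [Finset.sum_comm]
    simp [permMat, Fintype.card_perm]
  simp only [h1] at h2
  rw [← h2]
  simp [mul_comm]

lemma exp_bx (d : ℕ) (hd : 0 < d) (p : ℝ) (u v : Fin d) :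
    ∑ a, bw d p a * bx d a u v = p * (if u = v then 1 else 0) + (1 - p) / d := by
  have hf : (Nat.factorial d : ℝ) ≠ 0 := by positivity
  have hd' : (d : ℝ) ≠ 0 := by positivity
  have h := sum_permMat d u v
  rw [Fintype.sum_prod_type]
  simp only [bw, bx, Fintype.sum_bool, if_true, Bool.false_eq_true, if_false, ← Finset.mul_sum,
    Finset.sum_const, Finset.card_univ, Fintype.card_perm, Fintype.card_fin, nsmul_eq_mul,
    Matrix.one_apply]
  rw [← eq_div_iff hd'] at h
  rw [h]
  field_simp

lemma bx_cases (d : ℕ) (a) (u v : Fin d) : bx d a u v = 0 ∨ bx d a u v = 1 := by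
  unfold bx permMat
  split_ifs
  · rw [Matrix.one_apply]; split_ifs <;> simp
  · simp only [Matrix.of_apply]; split_ifs <;> simp

lemma exp_g (d : ℕ) (hd : 2 ≤ d) (p α β : ℝ) (hp0 : 0 ≤ p) (hp1 : p ≤ 1) (hα : 0 < α)
    (hβ : 0 < β) (hpa : α / 2 ≤ p) (t u v : Fin d) (huv : u ≠ v) :
    1 + 2 * p ^ 2 / β / d ≤ ∑ a, ∑ b, bw d p a * bw d p b *
      (bx d a t t * (2 * (1 - bx d b u v) / α + 2 * bx d b t t / (β * d))) := by
  have hd0 : 0 < d := by omega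
  have hdr : (2 : ℝ) ≤ d := by exact_mod_cast hd
  have e1 := exp_bx d hd0 p t t
  have e2 := exp_bx d hd0 p u v
  have e3 := sum_bw d p
  rw [if_pos rfl] at e1
  rw [if_neg huv] at e2
  have key : ∑ a, ∑ b, bw d p a * bw d p b *
      (bx d a t t * (2 * (1 - bx d b u v) / α + 2 * bx d b t t / (β * d)))
      = (∑ a, bw d p a * bx d a t t) * (2 / α * (∑ b, bw d p b - ∑ b, bw d p b * bx d b u v)
        + 2 / (β * d) * ∑ b, bw d p b * bx d b t t) := by
    rw [Finset.sum_mul]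
    refine Finset.sum_congr rfl fun a _ => ?_
    rw [← Finset.sum_sub_distrib, Finset.mul_sum, Finset.mul_sum, ← Finset.sum_add_distrib,
      Finset.mul_sum]
    refine Finset.sum_congr rfl fun b _ => ?_
    ring
  rw [key, e1, e2, e3]
  set x : ℝ := (1 - p) / d with hx
  have hx0 : 0 ≤ x := div_nonneg (by linarith) (by linarith)
  have hx1 : x ≤ 1 - p := div_le_self (by linarith) (by linarith)
  have h1 : p ≤ (p + x) * (1 - x) := by nlinarith
  have h2 : 1 ≤ 2 / α * ((p + x) * (1 - x)) := by
    calc (1 : ℝ) = 2 / α * (α / 2) := by field_simp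
      _ ≤ _ := mul_le_mul_of_nonneg_left (hpa.trans h1) (by positivity)
  have h3 : 2 * p ^ 2 / β / d ≤ 2 / (β * d) * (p + x) ^ 2 := by
    calc 2 * p ^ 2 / β / d = 2 / (β * d) * p ^ 2 := by field_simp
      _ ≤ _ := mul_le_mul_of_nonneg_left (by nlinarith) (by positivity)
  calc _ ≤ _ := add_le_add h2 h3
    _ = _ := by ring

lemma Xin_comm_diag (n d : ℕ) (ω : Sample n d) (i j : Fin n) (t q : Fin d) :
    XinRand n d ω j i q t = XinRand n d ω i j t q := by
  unfold XinRand
  rcases lt_trichotomy i j with h | h | h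
  · simp [h, not_lt_of_gt h]
  · subst h; simp [Matrix.one_apply, eq_comm]
  · simp [h, not_lt_of_gt h]

/-- Coordinate index for the unordered pair. -/
def pairIdx {n : ℕ} (k i : Fin n) : Fin n × Fin n := if k < i then (k, i) else (i, k)

lemma Xin_eq {n d : ℕ} (ω : Sample n d) {k i : Fin n} (h : k ≠ i) (t q : Fin d) :
    XinRand n d ω k i t q = bx d (ω (pairIdx k i).1 (pairIdx k i).2)
      (if k < i then t else q) (if k < i then q else t) := by
  unfold XinRand pairIdx
  rcases lt_or_gt_of_ne h with h | h
  · simp [h, baseMat, bx]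
  · simp [h, not_lt_of_gt h, baseMat, bx]

lemma Xin_cases (n d : ℕ) (ω : Sample n d) {i j : Fin n} (h : i ≠ j) (t q : Fin d) :
    XinRand n d ω i j t q = 0 ∨ XinRand n d ω i j t q = 1 := by
  rw [Xin_eq ω h]; exact bx_cases _ _ _ _

lemma wt_eq (n d : ℕ) (p : ℝ) (ω : Sample n d) :
    wtJOM n d p ω = ∏ x : Fin n × Fin n, bw d p (ω x.1 x.2) := by
  rw [Fintype.prod_prod_type]; rfl

/-- The summand. -/
def Ysum (n d : ℕ) (α β : ℝ) (ω : Sample n d) (i j : Fin n) (t q : Fin d) : ℝ :=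
  ∑ k : {k : Fin n // k ≠ i ∧ k ≠ j}, XinRand n d ω k i t t *
    (2 * (1 - XinRand n d ω k j t q) / α + 2 * XinRand n d ω k j t t / (β * d))

lemma card_K {n : ℕ} {i j : Fin n} (h : i ≠ j) :
    (Fintype.card {k : Fin n // k ≠ i ∧ k ≠ j} : ℝ) = (n : ℝ) - 2 := by
  have h1 : Fintype.card {k : Fin n // k ≠ i ∧ k ≠ j} = n - 2 := by
    rw [Fintype.card_subtype]
    have : (Finset.univ.filter fun k : Fin n => k ≠ i ∧ k ≠ j) = Finset.univ \ {i, j} := by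
      ext k; simp
    rw [this, Finset.card_sdiff_of_subset (Finset.subset_univ _), Finset.card_pair h]
    simp
  have : 2 ≤ n := by
    have := Finset.card_le_univ ({i, j} : Finset (Fin n))
    rw [Finset.card_pair h] at this
    simpa using this
  rw [h1, Nat.cast_sub this]; simp

lemma pair_inj {n : ℕ} {i j : Fin n} (h : i ≠ j) :
    Function.Injective (Sum.elim (fun k : {k : Fin n // k ≠ i ∧ k ≠ j} => pairIdx k.1 i)
      (fun k : {k : Fin n // k ≠ i ∧ k ≠ j} => pairIdx k.1 j)) := by
  rintro (⟨a, ha⟩ | ⟨a, ha⟩) (⟨b, hb⟩ | ⟨b, hb⟩) hab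
  all_goals
    simp only [Sum.elim_inl, Sum.elim_inr, pairIdx] at hab
    split_ifs at hab <;> simp_all

lemma tail_bound (n d : ℕ) (hd : 2 ≤ d) (p α β : ℝ) (hp0 : 0 ≤ p) (hp1 : p ≤ 1) (hα : 0 < α)
    (hβ : 0 < β) (hpa : α / 2 ≤ p) (i j : Fin n) (hij : i ≠ j) (t q : Fin d) (htq : t ≠ q) :
    prJOM n d p (fun ω => Ysum n d α β ω i j t q ≤ ((n : ℝ) - 2) * (1 + p ^ 2 / β / d))
      ≤ Real.exp (-(((n : ℝ) - 2) * ((p ^ 2 / β / d) ^ 2 / (4 * (2 / α + 2 / β) ^ 2)))) := by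
  have hdr : (2 : ℝ) ≤ d := by exact_mod_cast hd
  have hc := chernoff (ι := Fin n × Fin n) (K := {k : Fin n // k ≠ i ∧ k ≠ j})
    (bw d p) (bw_nonneg hp0 hp1) (sum_bw d p) (fun k => pairIdx k.1 i) (fun k => pairIdx k.1 j)
    (pair_inj hij)
    (fun k a b => bx d a t t * (2 * (1 - bx d b (if k.1 < j then t else q)
      (if k.1 < j then q else t)) / α + 2 * bx d b t t / (β * d)))
    (2 / α + 2 / β) (1 + 2 * p ^ 2 / β / d) (p ^ 2 / β / d) (by positivity) (by positivity)
    ?_ ?_ ?_ ?_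
  · rw [card_K hij] at hc
    refine le_trans (le_of_eq ?_) hc
    unfold prJOM
    rw [← (Equiv.curry (Fin n) (Fin n) (Bool × Equiv.Perm (Fin d))).sum_comp]
    refine Finset.sum_congr rfl fun ω _ => ?_
    have e1 : ((n : ℝ) - 2) * (1 + p ^ 2 / β / d)
        = ((n : ℝ) - 2) * (1 + 2 * p ^ 2 / β / d - p ^ 2 / β / d) := by ring
    have e2 : Ysum n d α β (Equiv.curry (Fin n) (Fin n) (Bool × Equiv.Perm (Fin d)) ω) i j t q
        = ∑ k : {k : Fin n // k ≠ i ∧ k ≠ j}, bx d (ω (pairIdx k.1 i)) t t *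
          (2 * (1 - bx d (ω (pairIdx k.1 j)) (if k.1 < j then t else q)
          (if k.1 < j then q else t)) / α + 2 * bx d (ω (pairIdx k.1 j)) t t / (β * d)) := by
      unfold Ysum
      refine Finset.sum_congr rfl fun k _ => ?_
      rw [Xin_eq _ k.2.1, Xin_eq _ k.2.2, Xin_eq _ k.2.2]
      simp
    simp only [e2, e1, wt_eq]
    rfl
  · have h1 : p ^ 2 ≤ 1 := by nlinarith
    have h2 : p ^ 2 / β / d ≤ p ^ 2 / β := div_le_self (by positivity) (by linarith)
    have h3 : p ^ 2 / β ≤ 2 / β := div_le_div_of_nonneg_right (by linarith) hβ.le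
    have : 0 < 2 / α := by positivity
    linarith
  · intro k a b
    have : 0 ≤ 1 - bx d b (if k.1 < j then t else q) (if k.1 < j then q else t) := by
      rcases bx_cases d b (if k.1 < j then t else q) (if k.1 < j then q else t) with h | h <;>
        rw [h] <;> norm_num
    have h2 : 0 ≤ bx d a t t := by
      rcases bx_cases d a t t with h | h <;> rw [h]; norm_num
    have h3 : 0 ≤ bx d b t t := by
      rcases bx_cases d b t t with h | h <;> rw [h]; norm_num
    positivity
  · intro k a b
    have h1 : 2 * (1 - bx d b (if k.1 < j then t else q) (if k.1 < j then q else t)) / α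
        ≤ 2 / α := by
      refine div_le_div_of_nonneg_right ?_ hα.le
      rcases bx_cases d b (if k.1 < j then t else q) (if k.1 < j then q else t) with h | h <;>
        rw [h] <;> norm_num
    have h2 : 2 * bx d b t t / (β * d) ≤ 2 / β := by
      refine div_le_div₀ (by norm_num) ?_ hβ (by nlinarith)
      rcases bx_cases d b t t with h | h <;> rw [h] <;> norm_num
    have h4 : 0 < 2 / α + 2 / β := by positivity
    rcases bx_cases d a t t with h | h <;> rw [h] <;> linarith
  · intro k
    refine exp_g d hd p α β hp0 hp1 hα hβ hpa t _ _ ?_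
    split_ifs
    · exact htq
    · exact htq.symm

lemma delta_eq (n d : ℕ) (α β : ℝ) (ω : Sample n d) (i j : Fin n) (t q : Fin d)
    (h1 : aRand n d ω i j t t = 1) (h2 : aRand n d ω i j t q = -1) :
    deltaJOM n d (aRand n d ω) α β i j t q = 1 / (n : ℝ) * Ysum n d α β ω i j t q := by
  unfold deltaJOM Ysum
  congr 1
  rw [h1, h2]
  rw [← Finset.sum_subtype (Finset.univ.filter fun k : Fin n => k ≠ i ∧ k ≠ j) (by simp)
    (fun k => XinRand n d ω k i t t *
    (2 * (1 - XinRand n d ω k j t q) / α + 2 * XinRand n d ω k j t t / (β * d)))]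
  rw [Finset.sum_filter, Finset.sum_filter]
  refine Finset.sum_congr rfl fun k _ => ?_
  by_cases hk : k ≠ i ∧ k ≠ j
  · rw [if_pos hk]
    have hi : aRand n d ω k i t t = 1 - 2 * XinRand n d ω k i t t := rfl
    have e1 : aRand n d ω k j t t = 1 - 2 * XinRand n d ω k j t t := rfl
    have e2 : aRand n d ω k j t q = 1 - 2 * XinRand n d ω k j t q := rfl
    rcases Xin_cases n d ω hk.1 t t with h | h
    · rw [if_neg, h, zero_mul]
      rintro ⟨-, -, h'⟩
      rw [hi, h] at h'
      norm_num at h'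
    · rw [if_pos ⟨hk.1, hk.2, by rw [hi, h]; norm_num⟩, h, e1, e2]
      ring
  · rw [if_neg hk, if_neg]
    exact fun h => hk ⟨h.1, h.2.1⟩

lemma wt_nonneg {n d : ℕ} {p : ℝ} (hp0 : 0 ≤ p) (hp1 : p ≤ 1) (ω : Sample n d) :
    0 ≤ wtJOM n d p ω := by
  rw [wt_eq]; exact Finset.prod_nonneg fun _ _ => bw_nonneg hp0 hp1 _

lemma sum_wt (n d : ℕ) (p : ℝ) : ∑ ω : Sample n d, wtJOM n d p ω = 1 := by
  rw [← Equiv.sum_comp (Equiv.curry (Fin n) (Fin n) (Bool × Equiv.Perm (Fin d)))]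
  simp only [wt_eq, Equiv.curry_apply, Function.curry]
  have := Fintype.prod_sum (fun (_ : Fin n × Fin n) (a : Bool × Equiv.Perm (Fin d)) => bw d p a)
  simp only [sum_bw, Finset.prod_const_one] at this
  exact this.symm

lemma pr_le_one {n d : ℕ} {p : ℝ} (hp0 : 0 ≤ p) (hp1 : p ≤ 1) (E : Sample n d → Prop) :
    prJOM n d p E ≤ 1 := by
  rw [← sum_wt n d p]
  refine Finset.sum_le_sum fun ω _ => ?_
  split_ifs
  · exact le_rfl
  · exact wt_nonneg hp0 hp1 ω

lemma pr_union {n d : ℕ} {p : ℝ} (hp0 : 0 ≤ p) (hp1 : p ≤ 1) {I : Type} [Fintype I]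
    (G : Sample n d → Prop) (B : I → Sample n d → Prop)
    (h : ∀ ω, (∀ x, ¬ B x ω) → G ω) :
    1 - ∑ x, prJOM n d p (B x) ≤ prJOM n d p G := by
  rw [sub_le_iff_le_add, ← sum_wt n d p]
  unfold prJOM
  rw [Finset.sum_comm, ← Finset.sum_add_distrib]
  refine Finset.sum_le_sum fun ω _ => ?_
  have h0 := wt_nonneg hp0 hp1 ω
  have hn : ∀ x ∈ (Finset.univ : Finset I), 0 ≤ if B x ω then wtJOM n d p ω else 0 := by
    intro x _; split_ifs
    · exact h0
    · exact le_rfl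
  by_cases hG : G ω
  · rw [if_pos hG]
    have := Finset.sum_nonneg hn
    linarith
  · rw [if_neg hG, zero_add]
    have : ∃ x, B x ω := by
      by_contra hc
      push Not at hc
      exact hG (h ω hc)
    obtain ⟨x, hx⟩ := this
    calc wtJOM n d p ω = if B x ω then wtJOM n d p ω else 0 := by rw [if_pos hx]
      _ ≤ _ := Finset.single_le_sum hn (Finset.mem_univ x)

lemma good_bound (n d : ℕ) (hd : 2 ≤ d) (p α β : ℝ) (hp0 : 0 ≤ p) (hp1 : p ≤ 1) (hα : 0 < α)
    (hβ : 0 < β) (hpa : α / 2 ≤ p) (hn : 0 < n)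
    (hnd : (n : ℝ) ≤ ((n : ℝ) - 2) * (1 + p ^ 2 / β / d)) :
    1 - (n : ℝ) ^ 2 * (d : ℝ) ^ 2 *
      Real.exp (-(((n : ℝ) - 2) * ((p ^ 2 / β / d) ^ 2 / (4 * (2 / α + 2 / β) ^ 2))))
    ≤ prJOM n d p (fun ω =>
          ∀ i j : Fin n, i < j → ∀ t q : Fin d,
            aRand n d ω i j t t = 1 → aRand n d ω i j q q = 1 →
            aRand n d ω i j t q = -1 →
            1 < deltaJOM n d (aRand n d ω) α β i j t q ∧
            1 < deltaJOM n d (aRand n d ω) α β j i q t) := by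
  have hn' : (0 : ℝ) < n := by exact_mod_cast hn
  refine le_trans ?_ (pr_union hp0 hp1 (I := (Fin n × Fin n) × (Fin d × Fin d)) _
    (fun x ω => (x.1.1 ≠ x.1.2 ∧ x.2.1 ≠ x.2.2) ∧
      Ysum n d α β ω x.1.1 x.1.2 x.2.1 x.2.2 ≤ ((n : ℝ) - 2) * (1 + p ^ 2 / β / d)) ?_)
  · refine sub_le_sub_left ?_ 1
    set R := Real.exp (-(((n : ℝ) - 2) * ((p ^ 2 / β / d) ^ 2 / (4 * (2 / α + 2 / β) ^ 2))))
    calc _ ≤ ∑ _x : (Fin n × Fin n) × (Fin d × Fin d), R := by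
          refine Finset.sum_le_sum fun x _ => ?_
          by_cases hx : x.1.1 ≠ x.1.2 ∧ x.2.1 ≠ x.2.2
          · have := tail_bound n d hd p α β hp0 hp1 hα hβ hpa _ _ hx.1 _ _ hx.2
            simpa only [hx, true_and, ne_eq, not_false_eq_true, and_self] using this
          · simp only [hx, false_and]
            simp only [prJOM, if_false, Finset.sum_const_zero]
            exact (Real.exp_pos _).le
      _ = _ := by
          simp only [Finset.sum_const, Finset.card_univ, Fintype.card_prod, Fintype.card_fin,
            nsmul_eq_mul]
          push_cast; ring
  · intro ω hω i j hij t q h1 h2 h3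
    have htq : t ≠ q := by
      rintro rfl; rw [h1] at h3; norm_num at h3
    have main : ∀ (i j : Fin n) (t q : Fin d), i ≠ j → t ≠ q → aRand n d ω i j t t = 1 →
        aRand n d ω i j t q = -1 → 1 < deltaJOM n d (aRand n d ω) α β i j t q := by
      intro i j t q hij htq h1 h2
      rw [delta_eq n d α β ω i j t q h1 h2]
      have := hω ((i, j), (t, q))
      simp only [not_and, not_le] at this
      have := this ⟨hij, htq⟩
      rw [one_div_mul_eq_div, lt_div_iff₀ hn', one_mul]
      exact lt_of_le_of_lt hnd this
    have hcomm : ∀ t q, aRand n d ω j i q t = aRand n d ω i j t q := by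
      intro t q
      simp only [aRand, Matrix.of_apply, Xin_comm_diag n d ω i j t q]
    exact ⟨main i j t q hij.ne htq h1 h3,
      main j i q t hij.ne' htq.symm (by rw [hcomm, h2]) (by rw [hcomm, h3])⟩

/-- Under the random corruption model, if `p ≥ α/2` and `d(n)⁴ log n / n → 0`, then with
probability tending to one condition (C2) holds strictly. -/
theorem C2_strict_whp
    (d : ℕ → ℕ) (hd : ∀ n, 2 ≤ d n)
    (hdo : Filter.Tendsto (fun n : ℕ => (d n : ℝ) ^ 4 * Real.log n / n)
      Filter.atTop (nhds 0))
    (p α β : ℝ) (hp0 : 0 ≤ p) (hp1 : p ≤ 1) (hα : 0 < α) (hβ : 0 < β)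
    (hpa : α / 2 ≤ p) :
    Filter.Tendsto (fun n : ℕ =>
        prJOM n (d n) p (fun ω =>
          ∀ i j : Fin n, i < j → ∀ t q : Fin (d n),
            aRand n (d n) ω i j t t = 1 → aRand n (d n) ω i j q q = 1 →
            aRand n (d n) ω i j t q = -1 →
            1 < deltaJOM n (d n) (aRand n (d n) ω) α β i j t q ∧
            1 < deltaJOM n (d n) (aRand n (d n) ω) α β j i q t))
      Filter.atTop (nhds 1) := by
  have hp : 0 < p := by linarith
  set c : ℝ := p ^ 2 / β with hc
  have hc0 : 0 < c := by positivity
  set C : ℝ := c ^ 2 / (4 * (2 / α + 2 / β) ^ 2) with hC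
  have hC0 : 0 < C := by positivity
  set η : ℝ := min 1 (min (c / 4) (C / 10)) with hη
  have hη0 : 0 < η := lt_min one_pos (lt_min (by positivity) (by positivity))
  have hlow : Filter.Tendsto (fun n : ℕ => 1 - 1 / (n : ℝ)) Filter.atTop (nhds 1) := by
    simpa using tendsto_one_div_atTop_nhds_zero_nat.const_sub (1 : ℝ)
  refine tendsto_of_tendsto_of_tendsto_of_le_of_le' hlow tendsto_const_nhds ?_
    (Filter.Eventually.of_forall fun n => pr_le_one hp0 hp1 _)
  filter_upwards [hdo.eventually (gt_mem_nhds hη0), Filter.eventually_ge_atTop 4] with n hn1 hn4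
  have hn4' : (4 : ℝ) ≤ n := by exact_mod_cast hn4
  have hnpos : (0 : ℝ) < n := by linarith
  have hd1 : (1 : ℝ) ≤ d n := by exact_mod_cast (by have := hd n; omega : 1 ≤ d n)
  have hdpos : (0 : ℝ) < d n := by linarith
  have hlog : 1 ≤ Real.log n := by
    rw [Real.le_log_iff_exp_le hnpos]
    have := Real.exp_one_lt_d9
    linarith
  have hn2 : (d n : ℝ) ^ 4 * Real.log n ≤ η * n := by
    rw [div_lt_iff₀ hnpos] at hn1
    exact hn1.le
  have hd2 : (d n : ℝ) ^ 2 * Real.log n ≤ η * n :=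
    (mul_le_mul_of_nonneg_right (pow_le_pow_right₀ hd1 (by norm_num)) (by linarith)).trans hn2
  have hdn : (d n : ℝ) ≤ η * n := by
    refine le_trans ?_ hd2
    nlinarith [mul_le_mul_of_nonneg_left hlog (sq_nonneg (d n : ℝ))]
  have hη1 : η * n ≤ n := by
    have : η ≤ 1 := min_le_left _ _
    nlinarith
  have hη2 : η * n ≤ c / 4 * n :=
    mul_le_mul_of_nonneg_right ((min_le_right _ _).trans (min_le_left _ _)) hnpos.le
  have hη3 : η * n ≤ C / 10 * n :=
    mul_le_mul_of_nonneg_right ((min_le_right _ _).trans (min_le_right _ _)) hnpos.le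
  have hnd : (n : ℝ) ≤ ((n : ℝ) - 2) * (1 + p ^ 2 / β / d n) := by
    rw [← hc]
    have : 2 ≤ ((n : ℝ) - 2) * (c / d n) := by
      rw [mul_div_assoc', le_div_iff₀ hdpos]
      nlinarith
    linarith
  refine le_trans ?_ (good_bound n (d n) (hd n) p α β hp0 hp1 hα hβ hpa (by omega) hnd)
  refine sub_le_sub_left ?_ 1
  have hexp : Real.exp (-(((n : ℝ) - 2) * ((p ^ 2 / β / d n) ^ 2 / (4 * (2 / α + 2 / β) ^ 2))))
      ≤ 1 / (n : ℝ) ^ 5 := by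
    have e1 : (p ^ 2 / β / d n) ^ 2 / (4 * (2 / α + 2 / β) ^ 2) = C / (d n : ℝ) ^ 2 := by
      rw [hC, hc, div_pow _ (d n : ℝ)]
      rw [div_div, div_div, mul_comm]
    have e2 : 5 * Real.log n ≤ ((n : ℝ) - 2) * (C / (d n : ℝ) ^ 2) := by
      rw [mul_div_assoc', le_div_iff₀ (by positivity)]
      nlinarith
    have e3 : 1 / (n : ℝ) ^ 5 = Real.exp (-(5 * Real.log n)) := by
      rw [Real.exp_neg, one_div]
      congr 1
      have := Real.exp_nat_mul (Real.log n) 5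
      rw [Real.exp_log hnpos] at this
      rw [← this]
      norm_num
    rw [e1, e3]
    exact Real.exp_le_exp.2 (by linarith)
  have hdn' : (d n : ℝ) ^ 2 ≤ (n : ℝ) ^ 2 := pow_le_pow_left₀ hdpos.le (hdn.trans hη1) 2
  calc _ ≤ (n : ℝ) ^ 2 * (n : ℝ) ^ 2 * (1 / (n : ℝ) ^ 5) := by gcongr
    _ = 1 / n := by field_simp

end
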